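/- arXiv:0803.4126 — 5 statements merged into one kernel-verified Lean document; each statement's English description precedes it below -/
import Mathlib

section
/- For every unit vector y ∈ S, the tangent ball B_y is contained in the closed unit ball B, and B_y meets the unit sphere exactly in the point y, i.e. B_y ∩ S = {y}. Consequently, for every x ∈ S one has 𝒫(x) = {x}; that is, the multivalued retraction 𝒫 restricted to the boundary sphere is the identity. -/
open Metric

/-- A unit vector `x` lies in the ball of radius `3/4` internally tangent to the unit sphere
at `y` if and only if `x = y`. -/
theorem mem_closedBall_quarter_smul_iff {E : Type*} [NormedAddCommGroup E]
    [InnerProductSpace ℝ E] {x y : E} (hx : ‖x‖ = 1) (hy : ‖y‖ = 1) :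
    x ∈ closedBall ((1/4 : ℝ) • y) (3/4) ↔ x = y := by
  rw [mem_closedBall, dist_eq_norm]
  have hsq : ‖x - (1/4 : ℝ) • y‖ ^ 2 = 17 / 16 - inner ℝ x y / 2 := by
    rw [norm_sub_sq_real, norm_smul, inner_smul_right, hx, hy]
    norm_num
    ring
  constructor
  · intro h
    refine (inner_eq_one_iff_of_norm_eq_one (𝕜 := ℝ) hx hy).mp (le_antisymm ?_ ?_)
    · simpa [hx, hy] using real_inner_le_norm x y
    · nlinarith [norm_nonneg (x - (1/4 : ℝ) • y)]
  · rintro rfl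
    rw [real_inner_self_eq_norm_sq, hx] at hsq
    nlinarith

/-- The ball of radius `3/4` centred at a quarter of a unit vector lies in the unit ball. -/
theorem closedBall_quarter_smul_subset {E : Type*} [NormedAddCommGroup E]
    [NormedSpace ℝ E] {y : E} (hy : ‖y‖ = 1) :
    closedBall ((1/4 : ℝ) • y) (3/4) ⊆ closedBall (0 : E) 1 := by
  apply closedBall_subset_closedBall'
  rw [dist_zero_right, norm_smul, hy]
  norm_num

/-- For every unit vector `y` in the unit sphere of `E = ℝ^{n+1}`, the ball `B_y` of radius
`3/4` centered at `(1/4) • y` is contained in the closed unit ball, meets the unit sphere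
exactly in `{y}`, and consequently the multivalued retraction `𝒫` restricted to the sphere
is the identity: `𝒫(x) = {x}` for `x` in the sphere. -/
theorem stmt_0 (n : ℕ) (hn : 1 ≤ n) :
    (∀ y ∈ sphere (0 : EuclideanSpace ℝ (Fin (n + 1))) 1,
      closedBall ((1/4 : ℝ) • y) (3/4) ⊆
          closedBall (0 : EuclideanSpace ℝ (Fin (n + 1))) 1 ∧
      closedBall ((1/4 : ℝ) • y) (3/4) ∩
          sphere (0 : EuclideanSpace ℝ (Fin (n + 1))) 1 = {y}) ∧
    (∀ x ∈ sphere (0 : EuclideanSpace ℝ (Fin (n + 1))) 1,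
      {y ∈ sphere (0 : EuclideanSpace ℝ (Fin (n + 1))) 1 |
        x ∈ closedBall ((1/4 : ℝ) • y) (3/4)} = {x}) := by
  refine ⟨fun y hy => ?_, fun x hx => ?_⟩
  · rw [mem_sphere_zero_iff_norm] at hy
    refine ⟨closedBall_quarter_smul_subset hy, Set.ext fun x => ?_⟩
    rw [Set.mem_inter_iff, mem_sphere_zero_iff_norm, Set.mem_singleton_iff]
    constructor
    · rintro ⟨h, hx⟩
      exact (mem_closedBall_quarter_smul_iff hx hy).mp h
    · rintro rfl
      exact ⟨(mem_closedBall_quarter_smul_iff hy hy).mpr rfl, hy⟩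
  · rw [mem_sphere_zero_iff_norm] at hx
    ext y
    rw [Set.mem_ofPred_eq, mem_sphere_zero_iff_norm, Set.mem_singleton_iff]
    constructor
    · rintro ⟨hy, h⟩
      exact ((mem_closedBall_quarter_smul_iff hx hy).mp h).symm
    · rintro rfl
      exact ⟨hx, (mem_closedBall_quarter_smul_iff hx hx).mpr rfl⟩
end

section
/- Define H : (E × E) × ℝ → E × E by H((y,x), t) = (y, (1 − t·(1 − ‖x‖)) • x) (the fiberwise radial homotopy). Then H is continuous; H((y,x), 0) = (y,x) for all (y,x); for every (y,x) ∈ D and every t ∈ [0,1] one has H((y,x), t) ∈ D; and for every (y,x) ∈ D and every t with 0 < t ≤ 1 one has H((y,x), t) ∉ T. -/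
open Metric

section TangentBall

variable {V : Type*} [NormedAddCommGroup V] [NormedSpace ℝ V] {x y : V}

lemma norm_le_one_of_mem_tangentBall (hy : ‖y‖ = 1)
    (hx : x ∈ closedBall ((1/4 : ℝ) • y) (3/4)) : ‖x‖ ≤ 1 := by
  rw [mem_closedBall, dist_eq_norm] at hx
  have hy4 : ‖(1/4 : ℝ) • y‖ = 1/4 := by rw [norm_smul, hy]; norm_num
  linarith [norm_le_norm_sub_add x ((1/4 : ℝ) • y)]

lemma smul_mem_tangentBall (hy : ‖y‖ = 1) (hx : x ∈ closedBall ((1/4 : ℝ) • y) (3/4))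
    {c : ℝ} (hc : c ∈ Set.Icc (0 : ℝ) 1) : c • x ∈ closedBall ((1/4 : ℝ) • y) (3/4) := by
  have h0 : (0 : V) ∈ closedBall ((1/4 : ℝ) • y) (3/4) := by
    rw [mem_closedBall, dist_zero_left, norm_smul, hy]; norm_num
  exact (convex_closedBall _ _).smul_mem_of_zero_mem h0 hx hc

/-- The antipodal point `-(1/2) • y` of the tangent ball can only be reached from the ball by
scaling with a factor at least one. -/
lemma one_le_of_smul_eq_neg_half (hy : ‖y‖ = 1)
    (hx : x ∈ closedBall ((1/4 : ℝ) • y) (3/4)) {c : ℝ} (hc : 0 ≤ c)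
    (h : c • x = (-(1/2) : ℝ) • y) : 1 ≤ c := by
  rw [mem_closedBall, dist_eq_norm] at hx
  have hv : c • (x - (1/4 : ℝ) • y) = (-(1/2 + c/4)) • y := by
    rw [smul_sub, h]; module
  have hn := congrArg norm hv
  rw [norm_smul, norm_smul, hy, norm_neg, Real.norm_of_nonneg hc,
    Real.norm_of_nonneg (by positivity)] at hn
  nlinarith [mul_le_mul_of_nonneg_left hx hc]

end TangentBall

/-- The fiberwise radial homotopy `H((y,x),t) = (y, (1 − t(1 − ‖x‖)) • x)` is continuous,
is the identity at `t = 0`, maps `D` into `D` for all `t ∈ [0,1]`, and pushes `D` off the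
set `T = {(y, -(1/2) • y) : y ∈ S}` for every `t ∈ (0,1]`. -/
theorem stmt_6 (n : ℕ) (hn : 1 ≤ n)
    (H : (EuclideanSpace ℝ (Fin (n + 1)) × EuclideanSpace ℝ (Fin (n + 1))) × ℝ →
         EuclideanSpace ℝ (Fin (n + 1)) × EuclideanSpace ℝ (Fin (n + 1)))
    (hH : ∀ p, H p = (p.1.1, (1 - p.2 * (1 - ‖p.1.2‖)) • p.1.2))
    (D T : Set (EuclideanSpace ℝ (Fin (n + 1)) × EuclideanSpace ℝ (Fin (n + 1))))
    (hD : D = {p | p.1 ∈ sphere (0 : EuclideanSpace ℝ (Fin (n + 1))) 1 ∧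
      p.2 ∈ closedBall ((1/4 : ℝ) • p.1) (3/4)})
    (hT : T = {p | ∃ y ∈ sphere (0 : EuclideanSpace ℝ (Fin (n + 1))) 1,
      p = (y, (-(1/2) : ℝ) • y)}) :
    Continuous H ∧
    (∀ z, H (z, 0) = z) ∧
    (∀ z ∈ D, ∀ t ∈ Set.Icc (0 : ℝ) 1, H (z, t) ∈ D) ∧
    (∀ z ∈ D, ∀ t : ℝ, 0 < t → t ≤ 1 → H (z, t) ∉ T) := by
  obtain rfl : H = fun p => (p.1.1, (1 - p.2 * (1 - ‖p.1.2‖)) • p.1.2) := funext hH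
  subst hD hT
  refine ⟨by fun_prop, fun z => by simp, ?_, ?_⟩
  · rintro ⟨y, x⟩ ⟨hy, hx⟩ t ⟨ht0, ht1⟩
    have hy1 : ‖y‖ = 1 := mem_sphere_zero_iff_norm.mp hy
    have hx1 := norm_le_one_of_mem_tangentBall hy1 hx
    have hx0 := norm_nonneg x
    exact ⟨hy, smul_mem_tangentBall hy1 hx ⟨by nlinarith, by nlinarith⟩⟩
  · rintro ⟨y, x⟩ ⟨hy, hx⟩ t ht0 ht1 ⟨w, -, hw⟩
    obtain ⟨rfl, h⟩ := Prod.mk.inj hw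
    have hy1 : ‖y‖ = 1 := mem_sphere_zero_iff_norm.mp hy
    have hx1 := norm_le_one_of_mem_tangentBall hy1 hx
    have hx0 := norm_nonneg x
    dsimp only at h hx1 hx0 hy1
    have hc := one_le_of_smul_eq_neg_half hy1 hx (by nlinarith) h
    have hxn : ‖x‖ = 1 := by nlinarith
    have hn := congrArg norm h
    rw [norm_smul, norm_smul, hy1, hxn] at hn
    norm_num at hn
end

section
/- The set T is contained in D; D is a compact subset of E × E; and the complement D \ T is dense in D. -/
open Metric

/-- `T ⊆ D`, `D` is a compact subset of `E × E`, and `D \ T` is dense in `D`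
(i.e. `D` is contained in the closure of `D \ T`). -/
theorem stmt_7 (n : ℕ) (hn : 1 ≤ n)
    (D T : Set (EuclideanSpace ℝ (Fin (n + 1)) × EuclideanSpace ℝ (Fin (n + 1))))
    (hD : D = {p | p.1 ∈ sphere (0 : EuclideanSpace ℝ (Fin (n + 1))) 1 ∧
      p.2 ∈ closedBall ((1/4 : ℝ) • p.1) (3/4)})
    (hT : T = {p | ∃ y ∈ sphere (0 : EuclideanSpace ℝ (Fin (n + 1))) 1,
      p = (y, (-(1/2) : ℝ) • y)}) :
    T ⊆ D ∧ IsCompact D ∧ D ⊆ closure (D \ T) := by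
  have radial_mem : ∀ y ∈ sphere (0 : EuclideanSpace ℝ (Fin (n + 1))) 1, ∀ t : ℝ,
      -(1/2) ≤ t → t ≤ 1 → (y, t • y) ∈ D := by
    intro y hy t ht₀ ht₁
    rw [hD]
    refine ⟨hy, ?_⟩
    rw [mem_closedBall, dist_eq_norm, ← sub_smul, norm_smul, mem_sphere_zero_iff_norm.mp hy,
      mul_one, Real.norm_eq_abs, abs_le]
    constructor <;> linarith
  refine ⟨?_, ?_, ?_⟩
  · rw [hT]
    rintro _ ⟨y, hy, rfl⟩
    exact radial_mem y hy _ le_rfl (by norm_num)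
  · have hclosed : IsClosed D := by
      rw [hD]
      refine (isClosed_sphere.preimage continuous_fst).inter ?_
      exact isClosed_le (f := fun p : EuclideanSpace ℝ (Fin (n + 1)) ×
        EuclideanSpace ℝ (Fin (n + 1)) => dist p.2 ((1/4 : ℝ) • p.1))
        (by fun_prop) continuous_const
    refine ((isCompact_sphere 0 1).prod (isCompact_closedBall 0 1)).of_isClosed_subset hclosed ?_
    rw [hD]
    rintro ⟨y, x⟩ ⟨hy, hx⟩
    refine ⟨hy, closedBall_subset_closedBall' ?_ hx⟩
    rw [dist_zero_right, norm_smul, mem_sphere_zero_iff_norm.mp hy]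
    norm_num
  · intro p hp
    by_cases hpT : p ∈ T
    · rw [hT] at hpT
      obtain ⟨y, hy, rfl⟩ := hpT
      have hmem : (-(1/2) : ℝ) ∈ closure (Set.Ioo (-(1/2) : ℝ) 1) := by
        rw [closure_Ioo (by norm_num)]
        norm_num
      refine map_mem_closure (f := fun t : ℝ => (y, t • y)) (by fun_prop) hmem ?_
      intro t ht
      refine ⟨radial_mem y hy t ht.1.le ht.2.le, ?_⟩
      rw [hT]
      rintro ⟨z, -, hz⟩
      obtain ⟨rfl, h⟩ := Prod.mk.inj hz
      exact ht.1.ne' (smul_left_injective ℝ (ne_zero_of_mem_unit_sphere ⟨y, hy⟩) h)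
    · exact subset_closure ⟨hp, hpT⟩
end

section
/- T is a Z-set in D: for every ε > 0 there exists a continuous map F : D → E × E (D carrying the subspace topology of E × E) such that F(D) ⊆ D \ T and dist(F z, z) ≤ ε for every z ∈ D. -/
open Metric

/-- `T` is a `Z`-set in `D`: for every `ε > 0` there is a continuous map `F : D → E × E`
(`D` with the subspace topology) whose image lies in `D \ T` and which moves every point
of `D` by at most `ε`. -/
theorem stmt_8 (n : ℕ) (hn : 1 ≤ n)
    (D T : Set (EuclideanSpace ℝ (Fin (n + 1)) × EuclideanSpace ℝ (Fin (n + 1))))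
    (hD : D = {p | p.1 ∈ sphere (0 : EuclideanSpace ℝ (Fin (n + 1))) 1 ∧
      p.2 ∈ closedBall ((1/4 : ℝ) • p.1) (3/4)})
    (hT : T = {p | ∃ y ∈ sphere (0 : EuclideanSpace ℝ (Fin (n + 1))) 1,
      p = (y, (-(1/2) : ℝ) • y)}) :
    ∀ ε : ℝ, 0 < ε →
      ∃ F : D → EuclideanSpace ℝ (Fin (n + 1)) × EuclideanSpace ℝ (Fin (n + 1)),
        Continuous F ∧
        (∀ z : D, F z ∈ D \ T) ∧
        (∀ z : D, dist (F z) (z : EuclideanSpace ℝ (Fin (n + 1)) ×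
          EuclideanSpace ℝ (Fin (n + 1))) ≤ ε) := by
  subst hD hT
  intro ε hε
  -- contract each fibre `B_y` towards its centre by the factor `1 - t`
  obtain ⟨t, ht0, ht1, htε⟩ : ∃ t : ℝ, 0 < t ∧ t ≤ 1 ∧ t ≤ ε :=
    ⟨min 1 ε, lt_min one_pos hε, min_le_left _ _, min_le_right _ _⟩
  have norm_le : ∀ y x : EuclideanSpace ℝ (Fin (n + 1)), x ∈ closedBall ((1/4 : ℝ) • y) (3/4) →
      ‖(1 - t) • (x - (1/4 : ℝ) • y)‖ ≤ (1 - t) * (3/4) := by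
    intro y x hx
    rw [mem_closedBall_iff_norm] at hx
    rw [norm_smul, Real.norm_of_nonneg (sub_nonneg.2 ht1)]
    exact mul_le_mul_of_nonneg_left hx (sub_nonneg.2 ht1)
  refine ⟨fun z => (z.1.1, (1/4 : ℝ) • z.1.1 + (1 - t) • (z.1.2 - (1/4 : ℝ) • z.1.1)),
    by fun_prop, ?_, ?_⟩
  · rintro ⟨⟨y, x⟩, hy, hx⟩
    have h := norm_le y x hx
    refine ⟨⟨hy, ?_⟩, ?_⟩
    · rw [mem_closedBall_iff_norm, add_sub_cancel_left]
      linarith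
    · rintro ⟨y', -, heq⟩
      obtain ⟨rfl, h2⟩ := Prod.mk.inj heq
      dsimp only at h hy h2
      have hcenter : (1 - t) • (x - (1/4 : ℝ) • y) = (-(3/4) : ℝ) • y := by
        rw [eq_sub_of_add_eq' h2, ← sub_smul]
        norm_num
      rw [hcenter, norm_smul, mem_sphere_zero_iff_norm.1 hy] at h
      norm_num at h
      linarith
  · rintro ⟨⟨y, x⟩, hy, hx⟩
    dsimp only at hx
    rw [mem_closedBall_iff_norm] at hx
    have hmove : (1/4 : ℝ) • y + (1 - t) • (x - (1/4 : ℝ) • y) - x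
        = (-t) • (x - (1/4 : ℝ) • y) := by
      module
    rw [Prod.dist_eq, dist_self, dist_eq_norm, hmove, norm_smul, norm_neg,
      Real.norm_of_nonneg ht0.le]
    exact max_le hε.le (by nlinarith)
end

section
/- For every x ∈ E with 1/2 < ‖x‖ ≤ 1, the fiber 𝒫(x) = {y ∈ S : x ∈ B_y}, endowed with the subspace topology of E, is a contractible topological space (it is a nonempty proper closed spherical cap of the unit sphere). -/
open Metric

section SphericalCap

variable {F : Type*} [NormedAddCommGroup F] [InnerProductSpace ℝ F]

theorem inner_add_smul_left_of_norm_eq_one {u : F} (hu : ‖u‖ = 1) (y : F) (a t : ℝ) :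
    inner ℝ u (a • y + t • u) = a * inner ℝ u y + t := by
  rw [inner_add_right, real_inner_smul_right, real_inner_smul_right,
    real_inner_self_eq_norm_sq, hu]
  ring

theorem norm_smul_add_smul_sq_of_norm_eq_one {u y : F} (hu : ‖u‖ = 1) (hy : ‖y‖ = 1) (a t : ℝ) :
    ‖a • y + t • u‖ ^ 2 = a ^ 2 + t ^ 2 + 2 * a * t * inner ℝ u y := by
  rw [norm_add_sq_real, norm_smul, norm_smul, hu, hy, real_inner_smul_left, real_inner_smul_right,
    real_inner_comm, mul_one, mul_one, Real.norm_eq_abs, Real.norm_eq_abs, sq_abs, sq_abs]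
  ring

/-- Segments between unit vectors that are not antipodal avoid the origin. -/
theorem smul_add_smul_ne_zero_of_neg_one_lt_inner {u y : F} (hu : ‖u‖ = 1) (hy : ‖y‖ = 1)
    (h : -1 < inner ℝ u y) {a t : ℝ} (hat : a + t = 1) : a • y + t • u ≠ 0 := by
  intro hz
  have h1 := inner_add_smul_left_of_norm_eq_one hu y a t
  have h2 := inner_add_smul_left_of_norm_eq_one hy u t a
  rw [hz, inner_zero_right] at h1
  rw [add_comm, hz, inner_zero_right, real_inner_comm] at h2
  nlinarith

/-- Moving a unit vector `y` towards the unit vector `u` along the normalized segment does not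
decrease its inner product with `u`. -/
theorem inner_mul_norm_le_inner_smul_add_smul {u y : F} (hu : ‖u‖ = 1) (hy : ‖y‖ = 1)
    {a t : ℝ} (ha : 0 ≤ a) (ht : 0 ≤ t) (hat : a + t = 1) :
    inner ℝ u y * ‖a • y + t • u‖ ≤ inner ℝ u (a • y + t • u) := by
  have hs : |inner ℝ u y| ≤ 1 := by simpa [hu, hy] using abs_real_inner_le_norm u y
  obtain ⟨hs1, hs2⟩ := abs_le.mp hs
  have hz := norm_smul_add_smul_sq_of_norm_eq_one hu hy a t
  have hz0 := norm_nonneg (a • y + t • u)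
  rw [inner_add_smul_left_of_norm_eq_one hu]
  generalize ‖a • y + t • u‖ = r at *
  generalize inner ℝ u y = s at *
  have hr : r ≤ 1 := by nlinarith [mul_nonneg ha ht]
  rcases le_or_gt 0 (a * s + t) with hN | hN
  · rcases le_or_gt 0 s with h | h
    · nlinarith
    · nlinarith
  · have hs0 : s < 0 := by nlinarith
    have hsq : (a * s + t) ^ 2 ≤ (s * r) ^ 2 := by
      have hkey : (s * r) ^ 2 - (a * s + t) ^ 2 = (1 - s ^ 2) * (t * (-(t + 2 * a * s))) := by
        rw [mul_pow, hz]
        ring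
      have h1 : 0 ≤ 1 - s ^ 2 := by nlinarith
      have h2 : 0 ≤ -(t + 2 * a * s) := by nlinarith
      linarith [mul_nonneg h1 (mul_nonneg ht h2)]
    have := sq_le_sq.mp hsq
    rw [abs_of_neg hN, abs_of_nonpos (mul_nonpos_of_nonpos_of_nonneg hs0.le hz0)] at this
    linarith

/-- A nonempty proper closed spherical cap is contractible. -/
theorem contractibleSpace_sphericalCap {u : F} (hu : ‖u‖ = 1) {c : ℝ} (hc : -1 < c)
    (hc' : c ≤ 1) :
    ContractibleSpace ({y ∈ sphere (0 : F) 1 | c ≤ inner ℝ u y} : Set F) := by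
  rw [contractible_iff_id_nullhomotopic]
  have hne (t : unitInterval) (y : {y ∈ sphere (0 : F) 1 | c ≤ inner ℝ u y}) :
      (1 - t : ℝ) • (y : F) + (t : ℝ) • u ≠ 0 :=
    smul_add_smul_ne_zero_of_neg_one_lt_inner hu (mem_sphere_zero_iff_norm.mp y.2.1)
      (hc.trans_le y.2.2) (sub_add_cancel _ _)
  refine ⟨⟨u, by simp [hu], by simpa [real_inner_self_eq_norm_sq, hu] using hc'⟩, ⟨⟨⟨fun p =>
    ⟨‖(1 - p.1 : ℝ) • (p.2 : F) + (p.1 : ℝ) • u‖⁻¹ • ((1 - p.1 : ℝ) • (p.2 : F) + (p.1 : ℝ) • u),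
      ?_, ?_⟩, ?_⟩, ?_, ?_⟩⟩⟩
  · rw [mem_sphere_zero_iff_norm]
    exact norm_smul_inv_norm (𝕜 := ℝ) (hne p.1 p.2)
  · refine p.2.2.2.trans ?_
    rw [real_inner_smul_right, ← div_eq_inv_mul, le_div_iff₀ (norm_pos_iff.mpr (hne p.1 p.2))]
    exact inner_mul_norm_le_inner_smul_add_smul hu (mem_sphere_zero_iff_norm.mp p.2.2.1)
      (sub_nonneg.mpr p.1.2.2) p.1.2.1 (sub_add_cancel _ _)
  · refine Continuous.subtype_mk (Continuous.smul (Continuous.inv₀ ?_ ?_) ?_) _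
    · fun_prop
    · exact fun p => norm_ne_zero_iff.mpr (hne p.1 p.2)
    · fun_prop
  · intro y
    have hy := mem_sphere_zero_iff_norm.mp y.2.1
    ext1
    simp [hy]
  · intro y
    ext1
    simp [hu]

/-- The ball of radius `3/4` tangent from inside to the unit sphere at `y` is described by
an inner product inequality. -/
theorem mem_closedBall_smul_iff_le_inner {x y : F} (hy : ‖y‖ = 1) :
    x ∈ closedBall ((1/4 : ℝ) • y) (3/4) ↔ 2 * ‖x‖ ^ 2 - 1 ≤ inner ℝ x y := by
  have h := norm_sub_sq_real x ((1/4 : ℝ) • y)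
  rw [real_inner_smul_right, norm_smul, hy, Real.norm_of_nonneg (by norm_num)] at h
  rw [mem_closedBall, dist_eq_norm, ← sq_le_sq₀ (norm_nonneg _) (by norm_num), h]
  constructor <;> intro h <;> linarith

end SphericalCap

/-- For every `x` with `1/2 < ‖x‖ ≤ 1`, the fiber `𝒫(x) = {y ∈ S : x ∈ B_y}`, with the
subspace topology of `E`, is a contractible topological space. -/
theorem stmt_10 (n : ℕ) (hn : 1 ≤ n) (x : EuclideanSpace ℝ (Fin (n + 1)))
    (hx1 : 1/2 < ‖x‖) (hx2 : ‖x‖ ≤ 1) :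
    ContractibleSpace
      ({y ∈ sphere (0 : EuclideanSpace ℝ (Fin (n + 1))) 1 |
        x ∈ closedBall ((1/4 : ℝ) • y) (3/4)} :
        Set (EuclideanSpace ℝ (Fin (n + 1)))) := by
  have hx0 : 0 < ‖x‖ := by linarith
  have hu : ‖‖x‖⁻¹ • x‖ = 1 := norm_smul_inv_norm (𝕜 := ℝ) (norm_pos_iff.mp hx0)
  have hc : -1 < ‖x‖⁻¹ * (2 * ‖x‖ ^ 2 - 1) := by
    rw [← div_eq_inv_mul, lt_div_iff₀ hx0]
    nlinarith
  have hc' : ‖x‖⁻¹ * (2 * ‖x‖ ^ 2 - 1) ≤ 1 := by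
    rw [← div_eq_inv_mul, div_le_iff₀ hx0]
    nlinarith
  have hcap : {y ∈ sphere (0 : EuclideanSpace ℝ (Fin (n + 1))) 1 |
      x ∈ closedBall ((1/4 : ℝ) • y) (3/4)} =
      {y ∈ sphere (0 : EuclideanSpace ℝ (Fin (n + 1))) 1 |
        ‖x‖⁻¹ * (2 * ‖x‖ ^ 2 - 1) ≤ inner ℝ (‖x‖⁻¹ • x) y} := by
    ext y
    refine and_congr_right fun hy => ?_
    rw [mem_closedBall_smul_iff_le_inner (mem_sphere_zero_iff_norm.mp hy), real_inner_smul_left]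
    exact (mul_le_mul_iff_right₀ (inv_pos.mpr hx0)).symm
  rw [hcap]
  exact contractibleSpace_sphericalCap hu hc hc'
end
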